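/- Let [G:H] = 2 with |H| = n, and let S₁, S₂ ⊆ G \ H partition G \ H (S₁ ∪ S₂ = G\H, S₁ ∩ S₂ = ∅), with |S₁| = k. If f is an eigenfunction of the adjacency operator of G(G,H,S₁) with eigenvalue μ, where μ ≠ k and μ ≠ −k, then f is an eigenfunction of the adjacency operator of G(G,H,S₂) with eigenvalue −μ. -/

import Mathlib

open scoped Pointwise Classical

def pairGraph {G : Type*} [Group G] (H : Subgroup G) (S : Set G) : SimpleGraph G :=
  SimpleGraph.fromRel (fun x y => ∃ h ∈ (H : Set G), ∃ s ∈ S, x = h ∧ y = h * s)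

/-- The adjacency operator of a graph on `G`, on complex-valued functions. -/
noncomputable def adjOp {G : Type*} [Fintype G] (Γ : SimpleGraph G) (f : G → ℂ) : G → ℂ :=
  fun x => ∑ y : G, if Γ.Adj x y then f y else 0

section PairGraph

theorem sum_ite_mem_eq_ncard_mul {α : Type*} [Fintype α] (S : Set α) (c : ℂ) :
    (∑ s : α, if s ∈ S then c else 0) = S.ncard * c := by
  rw [← Finset.sum_filter, Finset.sum_const, nsmul_eq_mul, Set.ncard_eq_toFinset_card']
  congr 3
  ext
  simp

variable {G : Type*} [Group G] {H : Subgroup G} {S : Set G}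

theorem pairGraph_adj_of_mem (hindex : H.index = 2) (hS : ∀ s ∈ S, s ∉ H) {x : G} (hx : x ∈ H)
    (y : G) : (pairGraph H S).Adj x y ↔ x⁻¹ * y ∈ S := by
  simp only [pairGraph, SimpleGraph.fromRel_adj, SetLike.mem_coe]
  constructor
  · rintro ⟨-, ⟨h, -, s, hs, rfl, rfl⟩ | ⟨h, hh, s, hs, rfl, rfl⟩⟩
    · simpa using hs
    · have := hS s hs
      rw [Subgroup.mul_mem_iff_of_index_two hindex] at hx
      tauto
  · refine fun h => ⟨?_, Or.inl ⟨x, hx, _, h, rfl, by group⟩⟩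
    rintro rfl
    exact hS _ h (by simp [H.one_mem])

theorem pairGraph_adj_of_notMem (hindex : H.index = 2) (hS : ∀ s ∈ S, s ∉ H) {x : G} (hx : x ∉ H)
    (y : G) : (pairGraph H S).Adj x y ↔ y⁻¹ * x ∈ S := by
  by_cases hy : y ∈ H
  · rw [SimpleGraph.adj_comm, pairGraph_adj_of_mem hindex hS hy]
  · have hyx : y⁻¹ * x ∉ S := fun h => hS _ h <| by
      rw [Subgroup.mul_mem_iff_of_index_two hindex, inv_mem_iff]
      tauto
    simp only [pairGraph, SimpleGraph.fromRel_adj, SetLike.mem_coe, hyx, iff_false]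
    rintro ⟨-, ⟨h, hh, s, -, rfl, -⟩ | ⟨h, hh, s, -, rfl, -⟩⟩ <;> contradiction

variable [Fintype G]

theorem adjOp_pairGraph_of_mem (hindex : H.index = 2) (hS : ∀ s ∈ S, s ∉ H) (f : G → ℂ) {x : G}
    (hx : x ∈ H) : adjOp (pairGraph H S) f x = ∑ s : G, if s ∈ S then f (x * s) else 0 := by
  simp only [adjOp, pairGraph_adj_of_mem hindex hS hx]
  exact Fintype.sum_equiv (Equiv.mulLeft x⁻¹) _ _ fun y => by simp

theorem adjOp_pairGraph_of_notMem (hindex : H.index = 2) (hS : ∀ s ∈ S, s ∉ H) (f : G → ℂ) {x : G}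
    (hx : x ∉ H) : adjOp (pairGraph H S) f x = ∑ s : G, if s ∈ S then f (x * s⁻¹) else 0 := by
  simp only [adjOp, pairGraph_adj_of_notMem hindex hS hx]
  exact Fintype.sum_equiv ((Equiv.inv G).trans (Equiv.mulRight x)) _ _ fun y => by simp

theorem sum_mem_adjOp_pairGraph (hindex : H.index = 2) (hS : ∀ s ∈ S, s ∉ H) (f : G → ℂ) :
    (∑ x : G, if x ∈ H then adjOp (pairGraph H S) f x else 0) =
      S.ncard * ∑ x : G, if x ∈ H then 0 else f x := by
  have h (x : G) : (if x ∈ H then adjOp (pairGraph H S) f x else 0) =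
      ∑ s : G, if s ∈ S then (if x ∈ H then f (x * s) else 0) else 0 := by
    split_ifs with hx
    · exact adjOp_pairGraph_of_mem hindex hS f hx
    · simp
  simp only [h]
  rw [Finset.sum_comm, ← sum_ite_mem_eq_ncard_mul]
  refine Finset.sum_congr rfl fun s _ => ?_
  split_ifs with hs
  · refine Fintype.sum_equiv (Equiv.mulRight s) _ _ fun x => ?_
    simp [Subgroup.mul_mem_iff_of_index_two hindex, hS s hs]
  · simp

theorem sum_notMem_adjOp_pairGraph (hindex : H.index = 2) (hS : ∀ s ∈ S, s ∉ H) (f : G → ℂ) :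
    (∑ x : G, if x ∈ H then 0 else adjOp (pairGraph H S) f x) =
      S.ncard * ∑ x : G, if x ∈ H then f x else 0 := by
  have h (x : G) : (if x ∈ H then 0 else adjOp (pairGraph H S) f x) =
      ∑ s : G, if s ∈ S then (if x ∈ H then 0 else f (x * s⁻¹)) else 0 := by
    split_ifs with hx
    · simp
    · exact adjOp_pairGraph_of_notMem hindex hS f hx
  simp only [h]
  rw [Finset.sum_comm, ← sum_ite_mem_eq_ncard_mul]
  refine Finset.sum_congr rfl fun s _ => ?_
  split_ifs with hs
  · refine Fintype.sum_equiv (Equiv.mulRight s⁻¹) _ _ fun x => ?_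
    simp [Subgroup.mul_mem_iff_of_index_two hindex, hS s hs]
  · simp

/-- The adjacency operators of complementary pair graphs add up to that of the complete
bipartite graph between `H` and its complement. -/
theorem adjOp_pairGraph_add (hindex : H.index = 2) {T : Set G}
    (hunion : S ∪ T = Set.univ \ (H : Set G)) (hdisj : S ∩ T = ∅) (f : G → ℂ) (x : G) :
    adjOp (pairGraph H S) f x + adjOp (pairGraph H T) f x =
      if x ∈ H then ∑ y : G, (if y ∈ H then 0 else f y) else ∑ y : G, if y ∈ H then f y else 0 := by
  have hu (s : G) : s ∈ S ∨ s ∈ T ↔ s ∉ H := by simpa using Set.ext_iff.1 hunion s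
  have hd (s : G) : ¬(s ∈ S ∧ s ∈ T) := by simpa using Set.ext_iff.1 hdisj s
  have hS (s) (h : s ∈ S) : s ∉ H := (hu s).1 (Or.inl h)
  have hT (s) (h : s ∈ T) : s ∉ H := (hu s).1 (Or.inr h)
  have hsplit (s : G) (c : ℂ) :
      (if s ∈ S then c else 0) + (if s ∈ T then c else 0) = if s ∈ H then 0 else c := by
    have := hu s
    have := hd s
    by_cases s ∈ S <;> by_cases s ∈ T <;> by_cases s ∈ H <;> simp_all
  split_ifs with hx
  · rw [adjOp_pairGraph_of_mem hindex hS f hx, adjOp_pairGraph_of_mem hindex hT f hx,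
      ← Finset.sum_add_distrib]
    simp only [hsplit]
    refine Fintype.sum_equiv (Equiv.mulLeft x) _ _ fun s => ?_
    simp [Subgroup.mul_mem_iff_of_index_two hindex, hx]
  · rw [adjOp_pairGraph_of_notMem hindex hS f hx, adjOp_pairGraph_of_notMem hindex hT f hx,
      ← Finset.sum_add_distrib]
    simp only [hsplit]
    refine Fintype.sum_equiv ((Equiv.inv G).trans (Equiv.mulLeft x)) _ _ fun s => ?_
    by_cases hs : s ∈ H <;> simp [Subgroup.mul_mem_iff_of_index_two hindex, hx, hs]

end PairGraph

/-- with `[G:H] = 2`, `S₁ ⊔ S₂ = G \ H`, `|S₁| = k`, any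
eigenfunction `f` of `𝒢(G,H,S₁)` with eigenvalue `μ ∉ {k, −k}` is an
eigenfunction of `𝒢(G,H,S₂)` with eigenvalue `−μ`. -/
theorem pairGraph_complement_spectrum {G : Type*} [Group G] [Fintype G]
    (H : Subgroup G) (S₁ S₂ : Set G)
    (hindex : H.index = 2)
    (hunion : S₁ ∪ S₂ = Set.univ \ (H : Set G))
    (hdisj : S₁ ∩ S₂ = ∅)
    (k : ℕ) (hk : S₁.ncard = k)
    (f : G → ℂ) (hf : f ≠ 0)
    (μ : ℂ) (hμk : μ ≠ (k : ℂ)) (hμk' : μ ≠ -(k : ℂ))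
    (heig : ∀ x : G, adjOp (pairGraph H S₁) f x = μ * f x) :
    ∀ x : G, adjOp (pairGraph H S₂) f x = (-μ) * f x := by
  have hS (s) (h : s ∈ S₁) : s ∉ H := by
    have : s ∈ Set.univ \ (H : Set G) := hunion ▸ Or.inl h
    simpa using this
  have hA := sum_mem_adjOp_pairGraph hindex hS f
  have hB := sum_notMem_adjOp_pairGraph hindex hS f
  have hadd := adjOp_pairGraph_add hindex hunion hdisj f
  simp only [heig, hk, ← mul_ite_zero, ← Finset.mul_sum] at hA hB hadd
  have hmulB : (∑ x : G, if x ∈ H then 0 else μ * f x) = μ * ∑ x : G, if x ∈ H then 0 else f x := by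
    simp [Finset.mul_sum, mul_ite]
  rw [hmulB] at hB
  set A := ∑ x : G, if x ∈ H then f x else 0
  set B := ∑ x : G, if x ∈ H then 0 else f x
  have hne : (μ - k) * (μ + k) ≠ 0 :=
    mul_ne_zero (sub_ne_zero.2 hμk) (by rwa [← sub_neg_eq_add, sub_ne_zero])
  have hA0 : A = 0 := (mul_eq_zero.1 (by linear_combination μ * hA + k * hB :
    (μ - k) * (μ + k) * A = 0)).resolve_left hne
  have hB0 : B = 0 := (mul_eq_zero.1 (by linear_combination μ * hB + k * hA :
    (μ - k) * (μ + k) * B = 0)).resolve_left hne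
  intro x
  have := hadd x
  simp only [hA0, hB0, ite_self] at this
  linear_combination this
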